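/- Let λ ∈ (1/2, 1) and let R₁, R₂ be Hermitian n×n matrices with (1−λ)I < R_i < λI, and set H = R₁ − R₂, Q₁ = R₁/(I−R₁). If ‖H‖₂ < 1−λ (Hilbert–Schmidt norm), then the series for S₂(R₁‖R₂) := R₁(log R₁ − log R₂) + (I−R₁)(log(I−R₁) − log(I−R₂)) obtained by expanding the logarithms converges absolutely, all terms linear in H cancel after taking Tr (I+Q₁)·(·), and there exists δ > 0 depending only on λ (one may take δ = min((1−λ)/2, (1−λ)³/(8λ))) such that ‖H‖₂ < δ implies Tr (I+Q₁) S₂(R₁‖R₂) ≤ δ^{-1}‖H‖₂². -/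

import Mathlib

open scoped ComplexOrder

/-- Matrix logarithm defined through the expansion `log R = -∑_{k≥1} (I-R)^k / k`. -/
noncomputable def mlog {n : ℕ} (R : Matrix (Fin n) (Fin n) ℂ) : Matrix (Fin n) (Fin n) ℂ :=
  -∑' k : ℕ, (((k : ℂ) + 1)⁻¹) • ((1 : Matrix (Fin n) (Fin n) ℂ) - R) ^ (k + 1)

/-- Hilbert–Schmidt (Frobenius) norm of a complex matrix. -/
noncomputable def frobNorm {n : ℕ} (A : Matrix (Fin n) (Fin n) ℂ) : ℝ :=
  Real.sqrt (∑ i, ∑ j, ‖A i j‖ ^ 2)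

/-- The matrix with eigenvalues `x` and eigenvectors the columns of the unitary matrix `U`. -/
noncomputable def unitaryDiag {n : ℕ} (U : Matrix.unitaryGroup (Fin n) ℂ) (x : Fin n → ℝ) :
    Matrix (Fin n) (Fin n) ℂ :=
  (U : Matrix (Fin n) (Fin n) ℂ) * Matrix.diagonal (fun i => (x i : ℂ)) *
    star (U : Matrix (Fin n) (Fin n) ℂ)

section unitaryDiag

variable {n : ℕ} (U V : Matrix.unitaryGroup (Fin n) ℂ)

theorem unitaryDiag_one : unitaryDiag U 1 = 1 := by
  simp [unitaryDiag]

theorem unitaryDiag_add (x y : Fin n → ℝ) :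
    unitaryDiag U (x + y) = unitaryDiag U x + unitaryDiag U y := by
  simp only [unitaryDiag, Pi.add_apply, Complex.ofReal_add, ← Matrix.diagonal_add, mul_add,
    add_mul]

theorem unitaryDiag_neg (x : Fin n → ℝ) : unitaryDiag U (-x) = -unitaryDiag U x := by
  simp only [unitaryDiag, Pi.neg_apply, Complex.ofReal_neg, ← Matrix.diagonal_neg, mul_neg,
    neg_mul]

theorem unitaryDiag_sub (x y : Fin n → ℝ) :
    unitaryDiag U (x - y) = unitaryDiag U x - unitaryDiag U y := by
  rw [sub_eq_add_neg, unitaryDiag_add, unitaryDiag_neg, ← sub_eq_add_neg]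

theorem unitaryDiag_mul (x y : Fin n → ℝ) :
    unitaryDiag U (x * y) = unitaryDiag U x * unitaryDiag U y := by
  have h : star (U : Matrix (Fin n) (Fin n) ℂ) * (U : Matrix (Fin n) (Fin n) ℂ) = 1 :=
    Unitary.coe_star_mul_self U
  calc unitaryDiag U (x * y)
      = (U : Matrix (Fin n) (Fin n) ℂ) * (Matrix.diagonal (fun i => (x i : ℂ)) *
          Matrix.diagonal (fun i => (y i : ℂ))) * star (U : Matrix (Fin n) (Fin n) ℂ) := by
        simp [unitaryDiag, Matrix.diagonal_mul_diagonal]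
    _ = (U : Matrix (Fin n) (Fin n) ℂ) * Matrix.diagonal (fun i => (x i : ℂ)) *
          (star (U : Matrix (Fin n) (Fin n) ℂ) * (U : Matrix (Fin n) (Fin n) ℂ)) *
          Matrix.diagonal (fun i => (y i : ℂ)) * star (U : Matrix (Fin n) (Fin n) ℂ) := by
        rw [h, mul_one]; simp only [mul_assoc]
    _ = unitaryDiag U x * unitaryDiag U y := by
        simp only [unitaryDiag, mul_assoc]

theorem unitaryDiag_pow (x : Fin n → ℝ) (k : ℕ) :
    unitaryDiag U (x ^ k) = unitaryDiag U x ^ k := by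
  induction k with
  | zero => simp [unitaryDiag_one]
  | succ k ih => rw [pow_succ, pow_succ, unitaryDiag_mul, ih]

theorem unitaryDiag_smul (c : ℝ) (x : Fin n → ℝ) :
    unitaryDiag U (c • x) = (c : ℂ) • unitaryDiag U x := by
  have h : Matrix.diagonal (fun i => (((c • x) i : ℝ) : ℂ))
      = (c : ℂ) • Matrix.diagonal (fun i => (x i : ℂ)) := by
    rw [← Matrix.diagonal_smul]
    congr 1
    ext i
    simp
  rw [unitaryDiag, h, Matrix.mul_smul, Matrix.smul_mul, unitaryDiag]

theorem unitaryDiag_const (c : ℝ) :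
    unitaryDiag U (fun _ => c) = (c : ℂ) • (1 : Matrix (Fin n) (Fin n) ℂ) := by
  rw [← unitaryDiag_one U, ← unitaryDiag_smul]
  congr 1
  ext i
  simp

theorem unitaryDiag_isHermitian (x : Fin n → ℝ) : (unitaryDiag U x).IsHermitian := by
  simp [Matrix.IsHermitian, unitaryDiag, Matrix.star_eq_conjTranspose, Matrix.conjTranspose_mul,
    Matrix.diagonal_conjTranspose, mul_assoc, Pi.star_def]

theorem unitaryDiag_inv {x : Fin n → ℝ} (hx : ∀ i, x i ≠ 0) :
    (unitaryDiag U x)⁻¹ = unitaryDiag U x⁻¹ := by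
  apply Matrix.inv_eq_right_inv
  rw [← unitaryDiag_mul, ← unitaryDiag_one U]
  congr 1
  ext i
  simp [hx i]

theorem pos_of_posDef_unitaryDiag {x : Fin n → ℝ} (h : (unitaryDiag U x).PosDef) (i : Fin n) :
    0 < x i := by
  have hU : star (U : Matrix (Fin n) (Fin n) ℂ) * (U : Matrix (Fin n) (Fin n) ℂ) = 1 :=
    Unitary.coe_star_mul_self U
  have h2 := h.conjTranspose_mul_mul_same (B := (U : Matrix (Fin n) (Fin n) ℂ))
    (Matrix.mulVec_injective_of_isUnit (Unitary.isUnit_coe (U := U)))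
  have h3 : (U : Matrix (Fin n) (Fin n) ℂ).conjTranspose * unitaryDiag U x *
      (U : Matrix (Fin n) (Fin n) ℂ) = Matrix.diagonal (fun i => (x i : ℂ)) := by
    rw [← Matrix.star_eq_conjTranspose, unitaryDiag]
    rw [mul_assoc, mul_assoc, hU, mul_one, ← mul_assoc, hU, one_mul]
  rw [h3, Matrix.posDef_diagonal_iff] at h2
  exact_mod_cast h2 i

theorem Matrix.IsHermitian.eq_unitaryDiag {A : Matrix (Fin n) (Fin n) ℂ} (hA : A.IsHermitian) :
    A = unitaryDiag hA.eigenvectorUnitary hA.eigenvalues := by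
  conv_lhs => rw [hA.spectral_theorem]
  simp [unitaryDiag, Unitary.conjStarAlgAut_apply, Function.comp_def]

theorem hasSum_log_unitaryDiag {x : Fin n → ℝ} (hx : ∀ i, |x i| < 1) :
    HasSum (fun k : ℕ => (((k : ℂ) + 1)⁻¹) • unitaryDiag U x ^ (k + 1))
      (-unitaryDiag U (fun i => Real.log (1 - x i))) := by
  have h1 : HasSum (fun (k : ℕ) (i : Fin n) => ((x i ^ (k + 1) / (k + 1) : ℝ) : ℂ))
      (fun i => ((-Real.log (1 - x i) : ℝ) : ℂ)) :=
    Pi.hasSum.mpr fun i => Complex.hasSum_ofReal.mpr (Real.hasSum_pow_div_log_of_abs_lt_one (hx i))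
  have h2 := (h1.matrix_diagonal.mul_left
    (U : Matrix (Fin n) (Fin n) ℂ)).mul_right (star (U : Matrix (Fin n) (Fin n) ℂ))
  rw [← unitaryDiag_neg]
  have terms_eq : (fun k : ℕ => (((k : ℂ) + 1)⁻¹) • unitaryDiag U x ^ (k + 1)) = fun k : ℕ =>
      (U : Matrix (Fin n) (Fin n) ℂ) *
        Matrix.diagonal (fun i => ((x i ^ (k + 1) / (k + 1) : ℝ) : ℂ)) *
        star (U : Matrix (Fin n) (Fin n) ℂ) := by
    ext1 k
    have h3 : (((k : ℂ) + 1)⁻¹) = (((k + 1 : ℝ)⁻¹ : ℝ) : ℂ) := by push_cast; rfl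
    rw [h3, ← unitaryDiag_pow, ← unitaryDiag_smul, unitaryDiag]
    congr 3
    ext i
    simp only [Pi.smul_apply, Pi.pow_apply, smul_eq_mul]
    congr 1
    ring
  rw [terms_eq]
  exact h2

theorem mlog_unitaryDiag {x : Fin n → ℝ} (hx : ∀ i, |1 - x i| < 1) :
    mlog (unitaryDiag U x) = unitaryDiag U (fun i => Real.log (x i)) := by
  have h := hasSum_log_unitaryDiag U (x := 1 - x) hx
  rw [unitaryDiag_sub, unitaryDiag_one] at h
  rw [mlog, h.tsum_eq, neg_neg]
  simp

theorem re_trace_unitaryDiag_mul_unitaryDiag (x y : Fin n → ℝ) :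
    (Matrix.trace (unitaryDiag U x * unitaryDiag V y)).re =
      ∑ i, ∑ j, ‖(star (U : Matrix (Fin n) (Fin n) ℂ) * (V : Matrix (Fin n) (Fin n) ℂ)) i j‖ ^ 2 *
        (x i * y j) := by
  set W := star (U : Matrix (Fin n) (Fin n) ℂ) * (V : Matrix (Fin n) (Fin n) ℂ) with hW
  have h : Matrix.trace (unitaryDiag U x * unitaryDiag V y) =
      Matrix.trace (Matrix.diagonal (fun i => (x i : ℂ)) *
        (W * Matrix.diagonal (fun i => (y i : ℂ)) * W.conjTranspose)) := by
    rw [unitaryDiag, mul_assoc, mul_assoc, Matrix.trace_mul_comm, unitaryDiag, hW,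
      Matrix.conjTranspose_mul]
    simp only [Matrix.star_eq_conjTranspose, Matrix.conjTranspose_conjTranspose, mul_assoc]
  rw [h, Matrix.trace, Complex.re_sum]
  refine Finset.sum_congr rfl fun i _ => ?_
  rw [Matrix.diag_apply, Matrix.diagonal_mul, Matrix.mul_apply, Complex.re_ofReal_mul,
    Complex.re_sum, Finset.mul_sum]
  refine Finset.sum_congr rfl fun j _ => ?_
  rw [Matrix.mul_diagonal, Matrix.conjTranspose_apply, mul_right_comm, RCLike.star_def,
    Complex.mul_conj, ← Complex.ofReal_mul, Complex.ofReal_re, Complex.normSq_eq_norm_sq]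
  ring

end unitaryDiag

theorem frobNorm_sq {n : ℕ} (A : Matrix (Fin n) (Fin n) ℂ) :
    frobNorm A ^ 2 = (Matrix.trace (A * A.conjTranspose)).re := by
  rw [frobNorm, Real.sq_sqrt (by positivity), Matrix.trace, Complex.re_sum]
  refine Finset.sum_congr rfl fun i _ => ?_
  rw [Matrix.diag_apply, Matrix.mul_apply, Complex.re_sum]
  refine Finset.sum_congr rfl fun j _ => ?_
  rw [Matrix.conjTranspose_apply, RCLike.star_def, Complex.mul_conj, Complex.ofReal_re,
    Complex.normSq_eq_norm_sq]

theorem frobNorm_unitaryDiag_sub_sq {n : ℕ} (U V : Matrix.unitaryGroup (Fin n) ℂ)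
    (a b : Fin n → ℝ) :
    frobNorm (unitaryDiag U a - unitaryDiag V b) ^ 2 =
      ∑ i, ∑ j, ‖(star (U : Matrix (Fin n) (Fin n) ℂ) * (V : Matrix (Fin n) (Fin n) ℂ)) i j‖ ^ 2 *
        (a i - b j) ^ 2 := by
  have h : Matrix.trace ((unitaryDiag U a - unitaryDiag V b) *
        (unitaryDiag U a - unitaryDiag V b)) =
      Matrix.trace (unitaryDiag U (a * a) * unitaryDiag V 1)
        - (Matrix.trace (unitaryDiag U a * unitaryDiag V b)
          + Matrix.trace (unitaryDiag U a * unitaryDiag V b))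
        + Matrix.trace (unitaryDiag U 1 * unitaryDiag V (b * b)) := by
    rw [unitaryDiag_one, unitaryDiag_one, unitaryDiag_mul, unitaryDiag_mul, sub_mul, mul_sub,
      mul_sub, Matrix.trace_sub, Matrix.trace_sub, Matrix.trace_sub,
      Matrix.trace_mul_comm (unitaryDiag V b) (unitaryDiag U a), mul_one, one_mul]
    ring
  rw [frobNorm_sq, ((unitaryDiag_isHermitian U a).sub (unitaryDiag_isHermitian V b)).eq, h]
  simp only [Complex.add_re, Complex.sub_re, re_trace_unitaryDiag_mul_unitaryDiag,
    ← Finset.sum_add_distrib, ← Finset.sum_sub_distrib]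
  refine Finset.sum_congr rfl fun i _ => Finset.sum_congr rfl fun j _ => ?_
  simp only [Pi.mul_apply, Pi.one_apply]
  ring

theorem weighted_binary_relative_entropy_le {l a b : ℝ} (hl : l < 1) (ha : a ∈ Set.Ioo (1 - l) l)
    (hb : b ∈ Set.Ioo (1 - l) l) :
    a * (1 - a)⁻¹ * (Real.log a - Real.log b) + (Real.log (1 - a) - Real.log (1 - b)) ≤
      ((1 - l) ^ 3)⁻¹ * (a - b) ^ 2 := by
  obtain ⟨ha1, ha2⟩ := ha
  obtain ⟨hb1, hb2⟩ := hb
  have hl0 : 0 < 1 - l := by linarith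
  have pa : 0 < a := by linarith
  have pb : 0 < b := by linarith
  have qa : 0 < 1 - a := by linarith
  have qb : 0 < 1 - b := by linarith
  have h1 : Real.log a - Real.log b ≤ a / b - 1 := by
    rw [← Real.log_div pa.ne' pb.ne']
    exact Real.log_le_sub_one_of_pos (div_pos pa pb)
  have h2 : Real.log (1 - a) - Real.log (1 - b) ≤ (1 - a) / (1 - b) - 1 := by
    rw [← Real.log_div qa.ne' qb.ne']
    exact Real.log_le_sub_one_of_pos (div_pos qa qb)
  calc _ ≤ a * (1 - a)⁻¹ * (a / b - 1) + ((1 - a) / (1 - b) - 1) := by gcongr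
    _ = ((1 - a) * b * (1 - b))⁻¹ * (a - b) ^ 2 := by
      field_simp
      ring
    _ ≤ ((1 - l) ^ 3)⁻¹ * (a - b) ^ 2 := by
      gcongr
      calc (1 - l) ^ 3 = (1 - l) * (1 - l) * (1 - l) := by ring
        _ ≤ (1 - a) * b * (1 - b) := by gcongr

theorem re_trace_weighted_relative_entropy {n : ℕ} (U V : Matrix.unitaryGroup (Fin n) ℂ)
    {a b : Fin n → ℝ} (ha : ∀ i, a i ∈ Set.Ioo (0 : ℝ) 1) (hb : ∀ i, b i ∈ Set.Ioo (0 : ℝ) 1) :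
    (Matrix.trace ((1 + unitaryDiag U a * (1 - unitaryDiag U a)⁻¹) *
      (unitaryDiag U a * (mlog (unitaryDiag U a) - mlog (unitaryDiag V b)) +
        (1 - unitaryDiag U a) * (mlog (1 - unitaryDiag U a) - mlog (1 - unitaryDiag V b))))).re =
      ∑ i, ∑ j, ‖(star (U : Matrix (Fin n) (Fin n) ℂ) * (V : Matrix (Fin n) (Fin n) ℂ)) i j‖ ^ 2 *
        (a i * (1 - a i)⁻¹ * (Real.log (a i) - Real.log (b j)) +
          (Real.log (1 - a i) - Real.log (1 - b j))) := by
  have key (W : Matrix.unitaryGroup (Fin n) ℂ) {x : Fin n → ℝ} (hx : ∀ i, x i ∈ Set.Ioo (0 : ℝ) 1) :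
      mlog (unitaryDiag W x) = unitaryDiag W (fun i => Real.log (x i)) ∧
        mlog (1 - unitaryDiag W x) = unitaryDiag W (fun i => Real.log (1 - x i)) := by
    refine ⟨mlog_unitaryDiag W fun i => ?_, ?_⟩
    · rw [abs_lt]; constructor <;> linarith [(hx i).1, (hx i).2]
    · rw [← unitaryDiag_one W, ← unitaryDiag_sub, mlog_unitaryDiag W fun i => ?_]
      · rfl
      · simp only [Pi.sub_apply, Pi.one_apply]
        rw [abs_lt]; constructor <;> linarith [(hx i).1, (hx i).2]
  have hne (i : Fin n) : (1 - a) i ≠ 0 := (sub_pos.mpr (ha i).2).ne'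
  have h1 : (1 : Matrix (Fin n) (Fin n) ℂ) - unitaryDiag U a = unitaryDiag U (1 - a) := by
    rw [unitaryDiag_sub, unitaryDiag_one]
  have hM : 1 + unitaryDiag U a * (1 - unitaryDiag U a)⁻¹ = unitaryDiag U (1 - a)⁻¹ := by
    rw [h1, unitaryDiag_inv U hne, ← unitaryDiag_mul, ← unitaryDiag_one U, ← unitaryDiag_add]
    congr 1
    ext i
    have := hne i
    simp only [Pi.sub_apply, Pi.one_apply, Pi.add_apply, Pi.mul_apply, Pi.inv_apply] at this ⊢
    field_simp
    ring
  have hMQ : unitaryDiag U (1 - a)⁻¹ * unitaryDiag U a = unitaryDiag U ((1 - a)⁻¹ * a) := by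
    rw [unitaryDiag_mul]
  have hM1 : unitaryDiag U (1 - a)⁻¹ * unitaryDiag U (1 - a) = 1 := by
    rw [← unitaryDiag_mul, ← unitaryDiag_one U]
    congr 1
    ext i
    exact inv_mul_cancel₀ (hne i)
  rw [hM, (key U ha).1, (key U ha).2, (key V hb).1, (key V hb).2, mul_add, ← mul_assoc,
    ← mul_assoc, hMQ, h1, hM1]
  have h : Matrix.trace (unitaryDiag U ((1 - a)⁻¹ * a) *
        (unitaryDiag U (fun i => Real.log (a i)) - unitaryDiag V (fun i => Real.log (b i))) +
        1 * (unitaryDiag U (fun i => Real.log (1 - a i)) -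
          unitaryDiag V (fun i => Real.log (1 - b i)))) =
      Matrix.trace (unitaryDiag U ((1 - a)⁻¹ * a * fun i => Real.log (a i)) * unitaryDiag V 1) -
        Matrix.trace (unitaryDiag U ((1 - a)⁻¹ * a) * unitaryDiag V (fun i => Real.log (b i))) +
        (Matrix.trace (unitaryDiag U (fun i => Real.log (1 - a i)) * unitaryDiag V 1) -
          Matrix.trace (unitaryDiag U 1 * unitaryDiag V (fun i => Real.log (1 - b i)))) := by
    rw [unitaryDiag_one, unitaryDiag_one, unitaryDiag_mul U _ (fun i => Real.log (a i)), mul_sub,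
      mul_one, mul_one, one_mul, one_mul, Matrix.trace_add, Matrix.trace_sub, Matrix.trace_sub]
  rw [h]
  simp only [Complex.add_re, Complex.sub_re, re_trace_unitaryDiag_mul_unitaryDiag,
    ← Finset.sum_add_distrib, ← Finset.sum_sub_distrib]
  refine Finset.sum_congr rfl fun i _ => Finset.sum_congr rfl fun j _ => ?_
  simp only [Pi.mul_apply, Pi.one_apply, Pi.inv_apply, Pi.sub_apply]
  ring

theorem exists_unitaryDiag_of_posDef {n : ℕ} {c d : ℝ} {A : Matrix (Fin n) (Fin n) ℂ}
    (hA : A.IsHermitian)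
    (hlow : (A - (c : ℂ) • (1 : Matrix (Fin n) (Fin n) ℂ)).PosDef)
    (hup : ((d : ℂ) • (1 : Matrix (Fin n) (Fin n) ℂ) - A).PosDef) :
    ∃ (U : Matrix.unitaryGroup (Fin n) ℂ) (a : Fin n → ℝ),
      A = unitaryDiag U a ∧ ∀ i, a i ∈ Set.Ioo c d := by
  refine ⟨hA.eigenvectorUnitary, hA.eigenvalues, hA.eq_unitaryDiag, fun i => ⟨?_, ?_⟩⟩
  · rw [hA.eq_unitaryDiag, ← unitaryDiag_const hA.eigenvectorUnitary, ← unitaryDiag_sub] at hlow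
    exact sub_pos.mp (pos_of_posDef_unitaryDiag _ hlow i)
  · rw [hA.eq_unitaryDiag, ← unitaryDiag_const hA.eigenvectorUnitary, ← unitaryDiag_sub] at hup
    exact sub_pos.mp (pos_of_posDef_unitaryDiag _ hup i)

/-- Quadratic bound on the weighted relative-entropy functional:
for Hermitian `R₁, R₂` with `(1-λ)I < Rᵢ < λI` (`λ ∈ (1/2,1)`), the defining log
expansions converge absolutely, and with
`S₂(R₁‖R₂) = R₁(log R₁ − log R₂) + (I−R₁)(log(I−R₁) − log(I−R₂))`,
`Q₁ = R₁(I−R₁)⁻¹`, there is `δ = min((1−λ)/2, (1−λ)³/(8λ)) > 0` such that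
`‖H‖₂ < δ` implies `Tr (I+Q₁) S₂(R₁‖R₂) ≤ δ⁻¹ ‖H‖₂²`, where `H = R₁ − R₂`. -/
theorem weighted_relative_entropy_quadratic_bound (n : ℕ) (lam : ℝ)
    (hlam1 : 1 / 2 < lam) (hlam2 : lam < 1)
    (R₁ R₂ : Matrix (Fin n) (Fin n) ℂ)
    (hR₁ : R₁.IsHermitian) (hR₂ : R₂.IsHermitian)
    (hlow₁ : (R₁ - ((1 - lam : ℝ) : ℂ) • (1 : Matrix (Fin n) (Fin n) ℂ)).PosDef)
    (hup₁ : (((lam : ℝ) : ℂ) • (1 : Matrix (Fin n) (Fin n) ℂ) - R₁).PosDef)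
    (hlow₂ : (R₂ - ((1 - lam : ℝ) : ℂ) • (1 : Matrix (Fin n) (Fin n) ℂ)).PosDef)
    (hup₂ : (((lam : ℝ) : ℂ) • (1 : Matrix (Fin n) (Fin n) ℂ) - R₂).PosDef) :
    let H := R₁ - R₂
    let Q₁ := R₁ * ((1 : Matrix (Fin n) (Fin n) ℂ) - R₁)⁻¹
    let S₂ := R₁ * (mlog R₁ - mlog R₂)
      + ((1 : Matrix (Fin n) (Fin n) ℂ) - R₁) * (mlog (1 - R₁) - mlog (1 - R₂))
    (Summable fun k : ℕ => (((k : ℂ) + 1)⁻¹) • ((1 : Matrix (Fin n) (Fin n) ℂ) - R₁) ^ (k + 1)) ∧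
    (Summable fun k : ℕ => (((k : ℂ) + 1)⁻¹) • ((1 : Matrix (Fin n) (Fin n) ℂ) - R₂) ^ (k + 1)) ∧
    (Summable fun k : ℕ => (((k : ℂ) + 1)⁻¹) • R₁ ^ (k + 1)) ∧
    (Summable fun k : ℕ => (((k : ℂ) + 1)⁻¹) • R₂ ^ (k + 1)) ∧
    ∃ δ : ℝ, 0 < δ ∧ δ = min ((1 - lam) / 2) ((1 - lam) ^ 3 / (8 * lam)) ∧
      (frobNorm H < δ →
        (Matrix.trace (((1 : Matrix (Fin n) (Fin n) ℂ) + Q₁) * S₂)).re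
          ≤ δ⁻¹ * frobNorm H ^ 2) := by
  obtain ⟨U, a, rfl, ha⟩ := exists_unitaryDiag_of_posDef hR₁ hlow₁ hup₁
  obtain ⟨V, b, rfl, hb⟩ := exists_unitaryDiag_of_posDef hR₂ hlow₂ hup₂
  have unit_of {x : ℝ} (hx : x ∈ Set.Ioo (1 - lam) lam) : x ∈ Set.Ioo (0 : ℝ) 1 :=
    ⟨by linarith [hx.1], hx.2.trans hlam2⟩
  have summable_of (W : Matrix.unitaryGroup (Fin n) ℂ) {x : Fin n → ℝ}
      (hx : ∀ i, x i ∈ Set.Ioo (0 : ℝ) 1) :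
      Summable fun k : ℕ => (((k : ℂ) + 1)⁻¹) • unitaryDiag W x ^ (k + 1) :=
    (hasSum_log_unitaryDiag W fun i => by
      rw [abs_lt]; constructor <;> linarith [(hx i).1, (hx i).2]).summable
  have summable_one_sub (W : Matrix.unitaryGroup (Fin n) ℂ) {x : Fin n → ℝ}
      (hx : ∀ i, x i ∈ Set.Ioo (0 : ℝ) 1) :
      Summable fun k : ℕ => (((k : ℂ) + 1)⁻¹) •
        ((1 : Matrix (Fin n) (Fin n) ℂ) - unitaryDiag W x) ^ (k + 1) := by
    rw [← unitaryDiag_one W, ← unitaryDiag_sub]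
    exact summable_of W fun i => ⟨sub_pos.mpr (hx i).2, sub_lt_self _ (hx i).1⟩
  have ha' (i : Fin n) := unit_of (ha i)
  have hb' (i : Fin n) := unit_of (hb i)
  intro H Q₁ S₂
  have hl : 0 < 1 - lam := by linarith
  have hδ : 0 < min ((1 - lam) / 2) ((1 - lam) ^ 3 / (8 * lam)) := by
    have : 0 < lam := by linarith
    positivity
  refine ⟨summable_one_sub U ha', summable_one_sub V hb', summable_of U ha', summable_of V hb',
    _, hδ, rfl, fun _ => ?_⟩
  have hC : ((1 - lam) ^ 3)⁻¹ ≤ (min ((1 - lam) / 2) ((1 - lam) ^ 3 / (8 * lam)))⁻¹ :=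
    inv_anti₀ hδ ((min_le_right _ _).trans (div_le_self (by positivity) (by linarith)))
  calc (Matrix.trace ((1 + Q₁) * S₂)).re
      = _ := re_trace_weighted_relative_entropy U V ha' hb'
    _ ≤ ((1 - lam) ^ 3)⁻¹ * frobNorm H ^ 2 := by
      rw [frobNorm_unitaryDiag_sub_sq, Finset.mul_sum]
      refine Finset.sum_le_sum fun i _ => ?_
      rw [Finset.mul_sum]
      refine Finset.sum_le_sum fun j _ => ?_
      rw [mul_left_comm]
      exact mul_le_mul_of_nonneg_left (weighted_binary_relative_entropy_le hlam2 (ha i) (hb j))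
        (by positivity)
    _ ≤ _ := by gcongr
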